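/- arXiv:1312.4726 — 2 statements merged into one kernel-verified Lean document; each statement's English description precedes it below -/
import Mathlib

section
/- For every integer n ≥ 0, all odd positive integers w₁ and w₂, and every real number x > 0, one has [2]_{q^{w₂}}^r · [w₁]_q^n · Σ_{j₁,...,j_r = 0}^{w₁d − 1} (−1)^{j₁+⋯+j_r} (Π_{l=1}^{r} χ(j_l)) q^{w₂·Σ_{l=1}^{r}(h−l+1)j_l} · E_{n,χ,q^{w₁}}^{(h,r)}(w₂x + (w₂/w₁)(j₁+⋯+j_r)) = [2]_{q^{w₁}}^r · [w₂]_q^n · Σ_{j₁,...,j_r = 0}^{w₂d − 1} (−1)^{j₁+⋯+j_r} (Π_{l=1}^{r} χ(j_l)) q^{w₁·Σ_{l=1}^{r}(h−l+1)j_l} · E_{n,χ,q^{w₂}}^{(h,r)}(w₁x + (w₁/w₂)(j₁+⋯+j_r)). -/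
open Finset

/-- The `q`-number `[x]_q = (1 - q^x)/(1 - q)`, with real exponent. -/
noncomputable def qnum (q x : ℝ) : ℝ := (1 - q ^ x) / (1 - q)

/-- The generalized higher-order `(h,q)`-Euler polynomial attached to a Dirichlet
character `χ` modulo `d`:
`E_{n,χ,q}^{(h,r)}(x) = [2]_q^r · Σ_{m₁,…,m_r ≥ 0} q^{Σ_l (h-l+1) m_l} (-1)^{m₁+⋯+m_r}
  (Π_l χ(m_l)) [x + m₁ + ⋯ + m_r]_q^n`,
where the summation index `l` runs over `Fin r` (so `h - l + 1` in 1-based indexing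
becomes `h - l` in 0-based indexing). -/
noncomputable def genqEuler {d : ℕ} (χ : DirichletCharacter ℂ d) (q : ℝ) (h : ℤ) (r : ℕ)
    (n : ℕ) (x : ℝ) : ℂ :=
  ((qnum q 2 : ℝ) : ℂ) ^ r *
    ∑' m : Fin r → ℕ,
      ((q ^ (∑ l : Fin r, (h - (l.val : ℤ)) * (m l : ℤ)) : ℝ) : ℂ) *
        (-1 : ℂ) ^ (∑ l : Fin r, m l) * (∏ l : Fin r, χ ((m l : ℕ) : ZMod d)) *
        ((qnum q (x + ∑ l : Fin r, (m l : ℝ)) ^ n : ℝ) : ℂ)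

theorem summable_pow_sum_pi {q : ℝ} (hq0 : 0 ≤ q) (hq1 : q < 1) (r : ℕ) :
    Summable fun m : Fin r → ℕ => q ^ ∑ l, m l := by
  induction r with
  | zero => exact Summable.of_finite
  | succ r ih =>
    rw [← (Fin.consEquiv fun _ => ℕ).summable_iff]
    refine ((summable_geometric_of_lt_one hq0 hq1).mul_of_nonneg ih
      (fun _ => pow_nonneg hq0 _) (fun _ => pow_nonneg hq0 _)).congr fun p => ?_
    simp [Fin.consEquiv, Fin.sum_univ_succ, pow_add]

theorem tsum_pi_eq_sum_tsum_mul_add {r N : ℕ} [NeZero N] {f : (Fin r → ℕ) → ℂ}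
    (hf : Summable f) :
    ∑' m, f m = ∑ i : Fin r → Fin N, ∑' k : Fin r → ℕ, f fun l => k l * N + i l := by
  let e : (Fin r → Fin N) × (Fin r → ℕ) ≃ (Fin r → ℕ) :=
    (Equiv.prodComm _ _).trans ((Equiv.arrowProdEquivProdArrow _ _ _).symm.trans
      (Equiv.piCongrRight fun _ => (Nat.divModEquiv N).symm))
  have he : Summable fun p => f (e p) := e.summable_iff.2 hf
  rw [← e.tsum_eq f, he.tsum_prod, tsum_fintype]
  rfl

theorem qnum_nonneg {q y : ℝ} (hq0 : 0 < q) (hq1 : q < 1) (hy : 0 ≤ y) : 0 ≤ qnum q y :=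
  div_nonneg (sub_nonneg.2 (Real.rpow_le_one hq0.le hq1.le hy)) (sub_nonneg.2 hq1.le)

theorem qnum_le {q : ℝ} (hq0 : 0 < q) (hq1 : q < 1) (y : ℝ) : qnum q y ≤ 1 / (1 - q) := by
  have := Real.rpow_pos_of_pos hq0 y
  exact div_le_div_of_nonneg_right (by linarith) (by linarith)

theorem qnum_natCast_mul_qnum_pow {q : ℝ} (hq0 : 0 < q) (hq1 : q < 1) {w : ℕ} (hw : 0 < w)
    (y : ℝ) : qnum q w * qnum (q ^ w) y = qnum q (w * y) := by
  have h1 : 1 - q ^ w ≠ 0 := (sub_pos.2 (pow_lt_one₀ hq0.le hq1 hw.ne')).ne'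
  have h2 : 1 - q ≠ 0 := (sub_pos.2 hq1).ne'
  rw [qnum, qnum, qnum, Real.rpow_natCast, Real.rpow_natCast_mul hq0.le]
  field_simp

/-- The summand of the series defining `genqEuler`. -/
noncomputable def genqEulerTerm {d : ℕ} (χ : DirichletCharacter ℂ d) (q : ℝ) (h : ℤ) (r n : ℕ)
    (x : ℝ) (m : Fin r → ℕ) : ℂ :=
  ((q ^ (∑ l : Fin r, (h - (l.val : ℤ)) * (m l : ℤ)) : ℝ) : ℂ) *
    (-1 : ℂ) ^ (∑ l : Fin r, m l) * (∏ l : Fin r, χ ((m l : ℕ) : ZMod d)) *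
    ((qnum q (x + ∑ l : Fin r, (m l : ℝ)) ^ n : ℝ) : ℂ)

theorem summable_genqEulerTerm {d : ℕ} (χ : DirichletCharacter ℂ d) {q : ℝ} (hq0 : 0 < q)
    (hq1 : q < 1) {h : ℤ} {r : ℕ} (hhr : (r : ℤ) ≤ h) (n : ℕ) {x : ℝ} (hx : 0 ≤ x) :
    Summable (genqEulerTerm χ q h r n x) := by
  refine Summable.of_norm_bounded ((summable_pow_sum_pi hq0.le hq1 r).mul_right
    ((1 / (1 - q)) ^ n)) fun m => ?_
  have hy : 0 ≤ x + ∑ l : Fin r, (m l : ℝ) := by positivity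
  have hexp : q ^ (∑ l : Fin r, (h - (l.val : ℤ)) * (m l : ℤ)) ≤ q ^ ∑ l, m l := by
    rw [← zpow_natCast]
    refine zpow_le_zpow_right_of_le_one₀ hq0 hq1.le ?_
    push_cast
    refine sum_le_sum fun l _ => le_mul_of_one_le_left (by positivity) ?_
    have := l.isLt
    omega
  have hχ : ‖∏ l : Fin r, χ ((m l : ℕ) : ZMod d)‖ ≤ 1 := by
    rw [norm_prod]
    exact prod_le_one (fun _ _ => norm_nonneg _) fun _ _ => χ.norm_le_one _
  have hn := pow_le_pow_left₀ (qnum_nonneg hq0 hq1 hy) (qnum_le hq0 hq1 _) n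
  have hn0 := pow_nonneg (qnum_nonneg hq0 hq1 hy) n
  rw [genqEulerTerm, norm_mul, norm_mul, norm_mul, norm_pow, norm_neg, norm_one, one_pow, mul_one,
    Complex.norm_of_nonneg (zpow_nonneg hq0.le _), Complex.norm_of_nonneg hn0]
  refine mul_le_mul ?_ hn hn0 (by positivity)
  exact (mul_le_of_le_one_right (zpow_nonneg hq0.le _) hχ).trans hexp

/-- The common summand of both sides of the symmetry identity: it is invariant under
simultaneously exchanging `w₁` with `w₂` and `j` with `i`. -/
noncomputable def symmKernel {d : ℕ} (χ : DirichletCharacter ℂ d) (q : ℝ) (h : ℤ) (r n : ℕ)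
    (x : ℝ) (w₁ w₂ : ℕ) (j i k : Fin r → ℕ) : ℂ :=
  ((q ^ (∑ l : Fin r, (h - (l.val : ℤ)) *
      ((w₂ * j l + w₁ * i l + w₁ * w₂ * d * k l : ℕ) : ℤ)) : ℝ) : ℂ) *
    (-1 : ℂ) ^ (∑ l, j l + ∑ l, i l + ∑ l, k l) *
    ((∏ l, χ ((j l : ℕ) : ZMod d)) * ∏ l, χ ((i l : ℕ) : ZMod d)) *
    ((qnum q (w₁ * w₂ * x + w₂ * ∑ l, (j l : ℝ) + w₁ * ∑ l, (i l : ℝ) +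
      w₁ * w₂ * d * ∑ l, (k l : ℝ)) ^ n : ℝ) : ℂ)

theorem symmKernel_swap {d : ℕ} (χ : DirichletCharacter ℂ d) (q : ℝ) (h : ℤ) (r n : ℕ)
    (x : ℝ) (w₁ w₂ : ℕ) (j i k : Fin r → ℕ) :
    symmKernel χ q h r n x w₁ w₂ j i k = symmKernel χ q h r n x w₂ w₁ i j k := by
  unfold symmKernel
  congr 1
  · congr 1
    · congr 1
      · simp only [add_comm (w₂ * j _), mul_comm w₁ w₂]
      · rw [add_comm (∑ l, j l)]
    · rw [mul_comm]
  · congr 3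
    ring

theorem mul_genqEulerTerm_eq_symmKernel {d : ℕ} (hdodd : Odd d)
    (χ : DirichletCharacter ℂ d) {q : ℝ} (hq0 : 0 < q) (hq1 : q < 1) (h : ℤ) (r n : ℕ)
    {w₁ w₂ : ℕ} (hw₁ : 0 < w₁) (hw₂odd : Odd w₂) (x : ℝ) (j i k : Fin r → ℕ) :
    ((qnum q w₁ ^ n : ℝ) : ℂ) *
      ((-1 : ℂ) ^ (∑ l : Fin r, j l) * (∏ l : Fin r, χ ((j l : ℕ) : ZMod d)) *
        ((q ^ ((w₂ : ℤ) * ∑ l : Fin r, (h - (l.val : ℤ)) * (j l : ℤ)) : ℝ) : ℂ) *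
        genqEulerTerm χ (q ^ w₁) h r n
          ((w₂ : ℝ) * x + ((w₂ : ℝ) / (w₁ : ℝ)) * ∑ l : Fin r, (j l : ℝ))
          (fun l => k l * (w₂ * d) + i l)) =
      symmKernel χ q h r n x w₁ w₂ j i k := by
  have hw : (w₁ : ℝ) ≠ 0 := by positivity
  have hχ : ∀ l, χ ((k l * (w₂ * d) + i l : ℕ) : ZMod d) = χ (i l : ZMod d) := fun l => by simp
  have hsign : (-1 : ℂ) ^ (∑ l, (k l * (w₂ * d) + i l)) = (-1) ^ (∑ l, i l + ∑ l, k l) := by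
    rw [sum_add_distrib, ← sum_mul, pow_add, pow_add, mul_comm (∑ l, k l), pow_mul,
      (hw₂odd.mul hdodd).neg_one_pow, mul_comm]
  have hq : q ^ ((w₂ : ℤ) * ∑ l : Fin r, (h - (l.val : ℤ)) * (j l : ℤ)) *
      (q ^ w₁) ^ (∑ l : Fin r, (h - (l.val : ℤ)) * ((k l * (w₂ * d) + i l : ℕ) : ℤ)) =
      q ^ (∑ l : Fin r, (h - (l.val : ℤ)) *
        ((w₂ * j l + w₁ * i l + w₁ * w₂ * d * k l : ℕ) : ℤ)) := by
    rw [← zpow_natCast q w₁, ← zpow_mul, ← zpow_add₀ hq0.ne', mul_sum, mul_sum,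
      ← sum_add_distrib]
    congr 1
    refine sum_congr rfl fun l _ => ?_
    push_cast
    ring
  have hn : qnum q w₁ * qnum (q ^ w₁) ((w₂ : ℝ) * x + ((w₂ : ℝ) / (w₁ : ℝ)) *
      ∑ l : Fin r, (j l : ℝ) + ∑ l, ((k l * (w₂ * d) + i l : ℕ) : ℝ)) =
      qnum q (w₁ * w₂ * x + w₂ * ∑ l, (j l : ℝ) + w₁ * ∑ l, (i l : ℝ) +
      w₁ * w₂ * d * ∑ l, (k l : ℝ)) := by
    rw [qnum_natCast_mul_qnum_pow hq0 hq1 hw₁]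
    congr 1
    push_cast
    rw [sum_add_distrib, ← sum_mul]
    field_simp
    ring
  rw [symmKernel, genqEulerTerm, ← hq, ← hn, add_assoc (∑ l, j l), pow_add _ (∑ l, j l), ← hsign]
  simp only [hχ, mul_pow, Complex.ofReal_mul]
  ring

theorem symmetrized_sum_eq_sum_symmKernel {d : ℕ} (hd0 : 0 < d) (hdodd : Odd d)
    (χ : DirichletCharacter ℂ d) {q : ℝ} (hq0 : 0 < q) (hq1 : q < 1)
    {r : ℕ} {h : ℤ} (hhr : (r : ℤ) ≤ h) (n : ℕ) {w₁ w₂ : ℕ} (hw₁ : 0 < w₁) (hw₂ : 0 < w₂)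
    (hw₂odd : Odd w₂) {x : ℝ} (hx : 0 < x) :
    ((qnum (q ^ w₂) 2 : ℝ) : ℂ) ^ r * ((qnum q w₁ ^ n : ℝ) : ℂ) *
        ∑ j : Fin r → Fin (w₁ * d),
          (-1 : ℂ) ^ (∑ l : Fin r, (j l : ℕ)) * (∏ l : Fin r, χ ((j l : ℕ) : ZMod d)) *
            ((q ^ ((w₂ : ℤ) * ∑ l : Fin r, (h - (l.val : ℤ)) * ((j l : ℕ) : ℤ)) : ℝ) : ℂ) *
            genqEuler χ (q ^ w₁) h r n
              ((w₂ : ℝ) * x + ((w₂ : ℝ) / (w₁ : ℝ)) * ∑ l : Fin r, ((j l : ℕ) : ℝ)) =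
      ((qnum (q ^ w₂) 2 : ℝ) : ℂ) ^ r * ((qnum (q ^ w₁) 2 : ℝ) : ℂ) ^ r *
        ∑ j : Fin r → Fin (w₁ * d), ∑ i : Fin r → Fin (w₂ * d), ∑' k : Fin r → ℕ,
          symmKernel χ q h r n x w₁ w₂ (fun l => j l) (fun l => i l) k := by
  have : NeZero (w₂ * d) := ⟨(Nat.mul_pos hw₂ hd0).ne'⟩
  rw [mul_assoc, mul_assoc]
  congr 1
  rw [mul_sum, mul_sum]
  refine sum_congr rfl fun j _ => ?_
  have hE : ∀ y : ℝ, 0 ≤ y → genqEuler χ (q ^ w₁) h r n y = ((qnum (q ^ w₁) 2 : ℝ) : ℂ) ^ r *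
      ∑ i : Fin r → Fin (w₂ * d), ∑' k : Fin r → ℕ,
        genqEulerTerm χ (q ^ w₁) h r n y fun l => k l * (w₂ * d) + i l := fun y hy => by
    rw [← tsum_pi_eq_sum_tsum_mul_add (summable_genqEulerTerm χ (pow_pos hq0 _)
      (pow_lt_one₀ hq0.le hq1 hw₁.ne') hhr n hy)]
    rfl
  simp only [← mul_genqEulerTerm_eq_symmKernel hdodd χ hq0 hq1 h r n hw₁ hw₂odd, tsum_mul_left,
    ← mul_sum]
  rw [hE _ (by positivity)]
  ring

/-- Theorem 2.2 (identity of symmetry for the generalized higher-order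
`(h,q)`-Euler polynomials): for odd `w₁, w₂ ∈ ℕ` and `x > 0`,
`[2]_{q^{w₂}}^r [w₁]_q^n Σ_{j₁,…,j_r=0}^{w₁d-1} (-1)^{Σ j_l} (Π χ(j_l))
    q^{w₂ Σ (h-l+1) j_l} E_{n,χ,q^{w₁}}^{(h,r)}(w₂x + (w₂/w₁)Σ j_l)`
is symmetric under interchanging `w₁` and `w₂`. -/
theorem genqEuler_symmetry_two_variables {d : ℕ} (hd0 : 0 < d) (hdodd : Odd d)
    (χ : DirichletCharacter ℂ d) (q : ℝ) (hq0 : 0 < q) (hq1 : q < 1)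
    (r : ℕ) (hr : 1 ≤ r) (h : ℤ) (hhr : (r : ℤ) ≤ h)
    (n : ℕ) (w₁ w₂ : ℕ) (hw₁ : 0 < w₁) (hw₁odd : Odd w₁) (hw₂ : 0 < w₂) (hw₂odd : Odd w₂)
    (x : ℝ) (hx : 0 < x) :
    ((qnum (q ^ w₂) 2 : ℝ) : ℂ) ^ r * ((qnum q w₁ ^ n : ℝ) : ℂ) *
        ∑ j : Fin r → Fin (w₁ * d),
          (-1 : ℂ) ^ (∑ l : Fin r, (j l : ℕ)) * (∏ l : Fin r, χ ((j l : ℕ) : ZMod d)) *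
            ((q ^ ((w₂ : ℤ) * ∑ l : Fin r, (h - (l.val : ℤ)) * ((j l : ℕ) : ℤ)) : ℝ) : ℂ) *
            genqEuler χ (q ^ w₁) h r n
              ((w₂ : ℝ) * x + ((w₂ : ℝ) / (w₁ : ℝ)) * ∑ l : Fin r, ((j l : ℕ) : ℝ))
      = ((qnum (q ^ w₁) 2 : ℝ) : ℂ) ^ r * ((qnum q w₂ ^ n : ℝ) : ℂ) *
        ∑ j : Fin r → Fin (w₂ * d),
          (-1 : ℂ) ^ (∑ l : Fin r, (j l : ℕ)) * (∏ l : Fin r, χ ((j l : ℕ) : ZMod d)) *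
            ((q ^ ((w₁ : ℤ) * ∑ l : Fin r, (h - (l.val : ℤ)) * ((j l : ℕ) : ℤ)) : ℝ) : ℂ) *
            genqEuler χ (q ^ w₂) h r n
              ((w₁ : ℝ) * x + ((w₁ : ℝ) / (w₂ : ℝ)) * ∑ l : Fin r, ((j l : ℕ) : ℝ)) := by
  rw [symmetrized_sum_eq_sum_symmKernel hd0 hdodd χ hq0 hq1 hhr n hw₁ hw₂ hw₂odd hx,
    symmetrized_sum_eq_sum_symmKernel hd0 hdodd χ hq0 hq1 hhr n hw₂ hw₁ hw₁odd hx, sum_comm]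
  simp only [symmKernel_swap χ q h r n x w₁ w₂]
  ring
end

section
/- For all integers m, n ≥ 0 and all real numbers x and y, one has Σ_{k=0}^{m} C(m,k) q^{kx} · E_{n+k,χ,q}^{(h,r)}(y) · [x]_q^{m−k} = Σ_{k=0}^{n} C(n,k) q^{−kx} · E_{m+k,χ,q}^{(h,r)}(x+y) · [−x]_q^{n−k}, where C(m,k) denotes the binomial coefficient. -/
open Finset

theorem qnum_add {q : ℝ} (hq0 : 0 < q) (hq1 : q < 1) (x z : ℝ) :
    qnum q (x + z) = q ^ x * qnum q z + qnum q x := by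
  have h1 : 1 - q ≠ 0 := by linarith
  unfold qnum
  rw [Real.rpow_add hq0]
  field_simp
  ring

theorem abs_qnum_add_le {q : ℝ} (hq0 : 0 < q) (hq1 : q < 1) (y : ℝ) {s : ℝ} (hs : 0 ≤ s) :
    |qnum q (y + s)| ≤ (1 + q ^ y) / (1 - q) := by
  have h1 : 0 < 1 - q := by linarith
  have h2 : q ^ s ≤ 1 := Real.rpow_le_one hq0.le hq1.le hs
  have h3 : 0 < q ^ y := Real.rpow_pos_of_pos hq0 y
  have h4 : 0 < q ^ s := Real.rpow_pos_of_pos hq0 s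
  unfold qnum
  rw [abs_div, abs_of_pos h1, Real.rpow_add hq0]
  gcongr
  rw [abs_le]
  constructor <;> nlinarith [mul_pos h3 h4]

theorem summable_prod_fin {f : ℕ → ℝ} (hf0 : ∀ i, 0 ≤ f i) (hf : Summable f) (r : ℕ) :
    Summable fun m : Fin r → ℕ => ∏ l, f (m l) := by
  induction r with
  | zero => exact (hasSum_fintype _).summable
  | succ r ih =>
    rw [← (Fin.consEquiv fun _ : Fin (r + 1) => ℕ).summable_iff]
    have := hf.mul_of_nonneg ih hf0 fun m => Finset.prod_nonneg fun l _ => hf0 (m l)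
    refine this.congr fun p => ?_
    simp [Fin.prod_univ_succ, Fin.consEquiv]

/-- Binomial expansion carried through a weighted series. -/
theorem sum_choose_mul_tsum {ι : Type*} {w f : ι → ℂ} (hs : ∀ j : ℕ, Summable fun i => w i * f i ^ j)
    (a b c : ℂ) (m n : ℕ) :
    ∑ k ∈ range (m + 1), (m.choose k : ℂ) * a ^ k * (c * ∑' i, w i * f i ^ (n + k)) * b ^ (m - k)
      = c * ∑' i, w i * (f i ^ n * (a * f i + b) ^ m) := by
  have key : ∀ i, w i * (f i ^ n * (a * f i + b) ^ m)
      = ∑ k ∈ range (m + 1), ((m.choose k : ℂ) * a ^ k * b ^ (m - k)) * (w i * f i ^ (n + k)) := by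
    intro i
    rw [add_pow, mul_sum, mul_sum]
    refine sum_congr rfl fun k _ => ?_
    ring
  simp_rw [key]
  rw [Summable.tsum_finsetSum fun k _ => (hs (n + k)).mul_left _, mul_sum]
  refine sum_congr rfl fun k _ => ?_
  rw [tsum_mul_left]
  ring

theorem summable_genqEuler {d : ℕ} (χ : DirichletCharacter ℂ d) {q : ℝ} (hq0 : 0 < q)
    (hq1 : q < 1) {h : ℤ} {r : ℕ} (hhr : (r : ℤ) ≤ h) (y : ℝ) (n : ℕ) :
    Summable fun m : Fin r → ℕ =>
      ((q ^ (∑ l : Fin r, (h - (l.val : ℤ)) * (m l : ℤ)) : ℝ) : ℂ) *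
        (-1 : ℂ) ^ (∑ l : Fin r, m l) * (∏ l : Fin r, χ ((m l : ℕ) : ZMod d)) *
        ((qnum q (y + ∑ l : Fin r, (m l : ℝ)) : ℝ) : ℂ) ^ n := by
  have hsum := (summable_prod_fin (fun i => pow_nonneg hq0.le i)
    (summable_geometric_of_lt_one hq0.le hq1) r).mul_right (((1 + q ^ y) / (1 - q)) ^ n)
  refine Summable.of_norm_bounded hsum fun m => ?_
  have hweight : q ^ (∑ l : Fin r, (h - (l.val : ℤ)) * (m l : ℤ)) ≤ ∏ l, q ^ m l := by
    rw [prod_pow_eq_pow_sum, ← zpow_natCast]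
    refine zpow_le_zpow_right_of_le_one₀ hq0 hq1.le ?_
    push_cast
    refine sum_le_sum fun l _ => ?_
    have := l.isLt
    exact le_mul_of_one_le_left (by positivity) (by omega)
  have hchar : ∏ l, ‖χ ((m l : ℕ) : ZMod d)‖ ≤ 1 :=
    prod_le_one (fun _ _ => norm_nonneg _) fun _ _ => χ.norm_le_one _
  have hbound := abs_qnum_add_le hq0 hq1 y (s := ∑ l : Fin r, (m l : ℝ)) (by positivity)
  simp only [norm_mul, norm_pow, norm_neg, norm_one, one_pow, mul_one, norm_prod,
    Complex.norm_real, Real.norm_eq_abs]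
  rw [abs_of_pos (zpow_pos hq0 _)]
  refine mul_le_mul ?_ (pow_le_pow_left₀ (abs_nonneg _) hbound n) (by positivity)
    (prod_nonneg fun _ _ => by positivity)
  exact (mul_le_of_le_one_right (zpow_pos hq0 _).le hchar).trans hweight

/-- Theorem 2.4 (symmetry in two variables for the generalized higher-order
`(h,q)`-Euler polynomials):
`Σ_{k=0}^{m} C(m,k) q^{kx} E_{n+k,χ,q}^{(h,r)}(y) [x]_q^{m-k}
  = Σ_{k=0}^{n} C(n,k) q^{-kx} E_{m+k,χ,q}^{(h,r)}(x+y) [-x]_q^{n-k}`. -/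
theorem genqEuler_symmetry {d : ℕ} (hd0 : 0 < d) (hdodd : Odd d)
    (χ : DirichletCharacter ℂ d) (q : ℝ) (hq0 : 0 < q) (hq1 : q < 1)
    (r : ℕ) (hr : 1 ≤ r) (h : ℤ) (hhr : (r : ℤ) ≤ h)
    (m n : ℕ) (x y : ℝ) :
    ∑ k ∈ Finset.range (m + 1),
        (m.choose k : ℂ) * ((q ^ ((k : ℝ) * x) : ℝ) : ℂ) * genqEuler χ q h r (n + k) y *
          ((qnum q x ^ (m - k) : ℝ) : ℂ)
      = ∑ k ∈ Finset.range (n + 1),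
        (n.choose k : ℂ) * ((q ^ (-((k : ℝ) * x)) : ℝ) : ℂ) *
          genqEuler χ q h r (m + k) (x + y) * ((qnum q (-x) ^ (n - k) : ℝ) : ℂ) := by
  have hrpow : ∀ (k : ℕ) (t : ℝ), q ^ ((k : ℝ) * t) = (q ^ t) ^ k := fun k t => by
    rw [mul_comm, Real.rpow_mul_natCast hq0.le]
  have hrpow_neg : ∀ k : ℕ, q ^ (-((k : ℝ) * x)) = (q ^ (-x)) ^ k := fun k => by
    rw [← hrpow, mul_neg]
  simp only [genqEuler, hrpow, hrpow_neg, Complex.ofReal_pow]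
  rw [sum_choose_mul_tsum (summable_genqEuler χ hq0 hq1 hhr y),
    sum_choose_mul_tsum (summable_genqEuler χ hq0 hq1 hhr (x + y))]
  congr 1
  refine tsum_congr fun v => ?_
  congr 1
  set s : ℝ := ∑ l : Fin r, (v l : ℝ)
  rw [← Complex.ofReal_mul, ← Complex.ofReal_add, ← Complex.ofReal_mul, ← Complex.ofReal_add,
    ← qnum_add hq0 hq1, ← qnum_add hq0 hq1, add_assoc x y s, neg_add_cancel_left, mul_comm]
end
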